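/- Let M^{4n+3} be a 3-quasi-Sasakian manifold with [ξ_α, ξ_β] = c ξ_γ, c ≠ 0, and rank 4l+3. Then for each α ∈ {1,2,3} and all vector fields X, Y on M, dη_α(X,Y) = (c/2) g(X, ψ_α Y). Consequently, restricted to the distribution E^{4l+3}, dη_α = (c/2) Φ_α. -/

import Mathlib

/-!
An abstract (Lie–Rinehart style) algebraic model of the differential geometry of
almost contact metric 3-structures: `F` plays the role of the algebra of smooth
functions on a manifold `M` of dimension `4n+3`, and `V` plays the role of the
`F`-module of smooth vector fields, acting on `F` by derivations and carrying a
Lie bracket, a Riemannian metric `g`, and three almost contact metric structures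
`(φ_α, ξ_α, η_α, g)`.
-/

noncomputable section

namespace QS3

/-- Cyclic (= even) permutations of `{0,1,2}`, modelling even permutations of `{1,2,3}`. -/
def Cyclic (a b c : Fin 3) : Prop :=
  (a, b, c) = (0, 1, 2) ∨ (a, b, c) = (1, 2, 0) ∨ (a, b, c) = (2, 0, 1)

/-- The algebraic model of the smooth structure of a manifold: an `ℝ`-algebra `F`
of smooth functions and an `F`-module `V` of vector fields acting on `F` by
derivations and carrying the Lie bracket of vector fields. -/
class SmoothSetting (F : Type) (V : Type) [CommRing F] [Algebra ℝ F]
    [AddCommGroup V] [Module F V] where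
  act : V → F → F
  bracket : V → V → V
  act_add : ∀ (X : V) (f₁ f₂ : F), act X (f₁ + f₂) = act X f₁ + act X f₂
  act_mul : ∀ (X : V) (f₁ f₂ : F), act X (f₁ * f₂) = act X f₁ * f₂ + f₁ * act X f₂
  act_const : ∀ (X : V) (r : ℝ), act X (algebraMap ℝ F r) = 0
  act_addLeft : ∀ (X Y : V) (f : F), act (X + Y) f = act X f + act Y f
  act_smulLeft : ∀ (f : F) (X : V) (h : F), act (f • X) h = f * act X h
  bracket_antisymm : ∀ X Y : V, bracket X Y = -bracket Y X
  bracket_addLeft : ∀ X Y Z : V, bracket (X + Y) Z = bracket X Z + bracket Y Z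
  bracket_act : ∀ (X Y : V) (f : F),
    act (bracket X Y) f = act X (act Y f) - act Y (act X f)
  bracket_smulRight : ∀ (X : V) (f : F) (Y : V),
    bracket X (f • Y) = f • bracket X Y + act X f • Y
  jacobi : ∀ X Y Z : V,
    bracket X (bracket Y Z) + bracket Y (bracket Z X) + bracket Z (bracket X Y) = 0

section d

variable (F V : Type) [CommRing F] [Algebra ℝ F] [AddCommGroup V] [Module F V]
  [SmoothSetting F V]

/-- The action of a vector field on a function (directional derivative). -/
def der (X : V) (f : F) : F := SmoothSetting.act X f

/-- The Lie bracket of vector fields. -/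
def lie (X Y : V) : V := SmoothSetting.bracket F X Y

/-- Exterior differential of a 1-form (with the `1/2` normalization convention,
so that `2 dθ(X,Y) = X θ(Y) - Y θ(X) - θ([X,Y])`). -/
def dOne (θ : V → F) (X Y : V) : F :=
  (2 : ℝ)⁻¹ • (der F V X (θ Y) - der F V Y (θ X) - θ (lie F V X Y))

/-- Exterior differential of a 2-form (with the `1/3` normalization convention). -/
def dTwo (ω : V → V → F) (X Y Z : V) : F :=
  (3 : ℝ)⁻¹ • (der F V X (ω Y Z) + der F V Y (ω Z X) + der F V Z (ω X Y)
    - ω (lie F V X Y) Z - ω (lie F V Y Z) X - ω (lie F V Z X) Y)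

end d

/-- An almost contact metric 3-structure on a manifold of dimension `4n+3`:
three almost contact metric structures `(φ_α, ξ_α, η_α, g)` satisfying the
quaternionic-type relations, together with a (local) orthonormal frame. -/
class ACM3 (F V : Type) [CommRing F] [Algebra ℝ F] [AddCommGroup V] [Module F V]
    [SmoothSetting F V] where
  n : ℕ
  g : V → V → F
  phi : Fin 3 → V → V
  xi : Fin 3 → V
  eta : Fin 3 → V → F
  g_symm : ∀ X Y, g X Y = g Y X
  g_addLeft : ∀ X Y Z, g (X + Y) Z = g X Z + g Y Z
  g_smulLeft : ∀ (f : F) (X Y : V), g (f • X) Y = f * g X Y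
  g_nondeg : ∀ X, (∀ Y, g X Y = 0) → X = 0
  phi_add : ∀ α (X Y : V), phi α (X + Y) = phi α X + phi α Y
  phi_smul : ∀ α (f : F) (X : V), phi α (f • X) = f • phi α X
  eta_eq : ∀ α X, eta α X = g X (xi α)
  acm_sq : ∀ α X, phi α (phi α X) = -X + eta α X • xi α
  eta_xi : ∀ α, eta α (xi α) = 1
  compat : ∀ α X Y, g (phi α X) (phi α Y) = g X Y - eta α X * eta α Y
  quat_phi : ∀ a b c, Cyclic a b c → ∀ X, phi c X = phi a (phi b X) - eta b X • xi a
  quat_phi' : ∀ a b c, Cyclic a b c → ∀ X, phi c X = -(phi b (phi a X)) + eta a X • xi b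
  quat_xi : ∀ a b c, Cyclic a b c → xi c = phi a (xi b)
  quat_xi' : ∀ a b c, Cyclic a b c → xi c = -(phi b (xi a))
  quat_eta : ∀ a b c, Cyclic a b c → ∀ X, eta c X = eta a (phi b X)
  quat_eta' : ∀ a b c, Cyclic a b c → ∀ X, eta c X = -(eta b (phi a X))
  frame : Fin (4 * n + 3) → V
  frame_orth : ∀ i j, g (frame i) (frame j) = if i = j then 1 else 0
  frame_span : ∀ X : V, X = ∑ i, g X (frame i) • frame i

section acm

variable (F V : Type) [CommRing F] [Algebra ℝ F] [AddCommGroup V] [Module F V]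
  [SmoothSetting F V] [ACM3 F V]

/-- The integer `n` (the manifold has dimension `4n+3`). -/
def dimn : ℕ := ACM3.n F V

/-- The Riemannian metric. -/
def gm (X Y : V) : F := ACM3.g X Y

/-- The structure tensors `φ_α`. -/
def ph (α : Fin 3) (X : V) : V := ACM3.phi F α X

/-- The Reeb vector fields `ξ_α`. -/
def rxi (α : Fin 3) : V := ACM3.xi F α

/-- The 1-forms `η_α`. -/
def et (α : Fin 3) (X : V) : F := ACM3.eta α X

/-- The orthonormal frame. -/
def fr (i : Fin (4 * dimn F V + 3)) : V := ACM3.frame i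

/-- The fundamental 2-form `Φ_α(X,Y) = g(X, φ_α Y)`. -/
def Phi (α : Fin 3) (X Y : V) : F := gm F V X (ph F V α Y)

/-- The Nijenhuis torsion `[φ_α, φ_α]` of `φ_α`. -/
def Nij (α : Fin 3) (X Y : V) : V :=
  ph F V α (ph F V α (lie F V X Y)) + lie F V (ph F V α X) (ph F V α Y)
    - ph F V α (lie F V (ph F V α X) Y) - ph F V α (lie F V X (ph F V α Y))

/-- The normality tensor `N⁽¹⁾_α = [φ_α, φ_α] + 2 dη_α ⊗ ξ_α`. -/
def NOne (α : Fin 3) (X Y : V) : V :=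
  Nij F V α X Y + ((2 : ℝ) • dOne F V (et F V α) X Y) • rxi F V α

/-- The structure `(φ_α, ξ_α, η_α)` is normal. -/
def IsNormal (α : Fin 3) : Prop := ∀ X Y, NOne F V α X Y = 0

/-- A 2-form is closed. -/
def IsClosedTwo (ω : V → V → F) : Prop := ∀ X Y Z, dTwo F V ω X Y Z = 0

/-- The structure `(φ_α, ξ_α, η_α, g)` is quasi-Sasakian: normal with closed
fundamental 2-form. -/
def IsQuasiSasakian (α : Fin 3) : Prop :=
  IsNormal F V α ∧ IsClosedTwo F V (Phi F V α)

/-- `M` is 3-cosymplectic: each structure is normal with `dη_α = 0` and `dΦ_α = 0`. -/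
def ThreeCosymplectic : Prop :=
  ∀ α, IsNormal F V α ∧ (∀ X Y, dOne F V (et F V α) X Y = 0) ∧
    IsClosedTwo F V (Phi F V α)

/-- `M` is 3-α-Sasakian with constant `a ≠ 0`: each structure is normal (an
`α`-Sasakian structure) and `dη_δ = a Φ_δ`. -/
def Is3AlphaSasakianWith (a : ℝ) : Prop :=
  a ≠ 0 ∧ (∀ δ, IsNormal F V δ) ∧
    ∀ (δ : Fin 3) (X Y : V), dOne F V (et F V δ) X Y = algebraMap ℝ F a * Phi F V δ X Y

/-- A vector field is horizontal: it lies in `H = ∩_α ker η_α`. -/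
def Horiz (X : V) : Prop := ∀ α, et F V α X = 0

/-- A vector field is vertical: it lies in `V = ⟨ξ₁, ξ₂, ξ₃⟩`. -/
def InVert (X : V) : Prop :=
  ∃ p q r : F, X = p • rxi F V 0 + q • rxi F V 1 + r • rxi F V 2

/-- The distribution `E^{4m} = {X ∈ H : i_X dη_α = 0}`. -/
def InE4m (X : V) : Prop :=
  Horiz F V X ∧ ∀ (α : Fin 3) (Y : V), dOne F V (et F V α) X Y = 0

/-- The distribution `E^{4l}`: the orthogonal complement of `E^{4m}` in `H`. -/
def InE4l (X : V) : Prop :=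
  Horiz F V X ∧ ∀ Y, InE4m F V Y → gm F V X Y = 0

/-- The distribution `E^{4l+3} = E^{4l} ⊕ V`. -/
def InE4l3 (X : V) : Prop :=
  ∃ Y Z, InE4l F V Y ∧ InVert F V Z ∧ X = Y + Z

/-- The distribution `E^{4m+3} = E^{4m} ⊕ V`. -/
def InE4m3 (X : V) : Prop :=
  ∃ Y Z, InE4m F V Y ∧ InVert F V Z ∧ X = Y + Z

/-- The horizontal component `X_H = X - ∑_α η_α(X) ξ_α` of a vector field. -/
def horComp (X : V) : V := X - ∑ α : Fin 3, et F V α X • rxi F V α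

/-- A vector field is basic with respect to the foliation defined by `E^{4m}`. -/
def BasicE4m (X : V) : Prop :=
  InE4l3 F V X ∧ ∀ W, InE4m F V W → InE4m F V (lie F V W X)

/-- A vector field is basic with respect to the foliation defined by `E^{4l+3}`. -/
def BasicE4l3 (X : V) : Prop :=
  InE4m F V X ∧ ∀ W, InE4l3 F V W → InE4l3 F V (lie F V W X)

end acm

/-- A 3-quasi-Sasakian structure: each of the three almost contact metric
structures is quasi-Sasakian.  We also record, as part of the structure, the
standard structural facts established for such manifolds in the literature
(Cappelletti Montano–De Nicola–Dileo): the Reeb commutation relations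
`[ξ_α, ξ_β] = c ξ_γ`, the splitting `H = E^{4l} ⊕ E^{4m}` (constancy of the
rank), the `φ_α`-invariance of both distributions, and the tensors `ψ_α`
(equal to `φ_α` on `E^{4l+3}` and vanishing on `E^{4m}` when the rank is
`4l+3`, i.e. `c ≠ 0`; equal to `φ_α` on `E^{4l}` and vanishing on `E^{4m+3}`
when the rank is `4l+1`, i.e. `c = 0`). -/
class ThreeQS (F V : Type) [CommRing F] [Algebra ℝ F] [AddCommGroup V] [Module F V]
    [SmoothSetting F V] [ACM3 F V] where
  qs : ∀ α, IsQuasiSasakian F V α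
  c : ℝ
  reeb_bracket : ∀ a b c', Cyclic a b c' →
    lie F V (rxi F V a) (rxi F V b) = algebraMap ℝ F c • rxi F V c'
  horiz_split : ∀ X, Horiz F V X → ∃ Y Z, InE4l F V Y ∧ InE4m F V Z ∧ X = Y + Z
  phi_E4l : ∀ α X, InE4l F V X → InE4l F V (ph F V α X)
  phi_E4m : ∀ α X, InE4m F V X → InE4m F V (ph F V α X)
  psi : Fin 3 → V → V
  psi_add : ∀ α (X Y : V), psi α (X + Y) = psi α X + psi α Y
  psi_smul : ∀ α (f : F) (X : V), psi α (f • X) = f • psi α X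
  psi_E4l : ∀ α X, InE4l F V X → psi α X = ph F V α X
  psi_E4m : ∀ α X, InE4m F V X → psi α X = 0
  psi_vert_of_ne : c ≠ 0 → ∀ α β, psi α (rxi F V β) = ph F V α (rxi F V β)
  psi_vert_of_eq : c = 0 → ∀ α β, psi α (rxi F V β) = 0

section tqs

variable (F V : Type) [CommRing F] [Algebra ℝ F] [AddCommGroup V] [Module F V]
  [SmoothSetting F V] [ACM3 F V] [ThreeQS F V]

/-- The constant `c` with `[ξ_α, ξ_β] = c ξ_γ`. -/
def cc : ℝ := ThreeQS.c F V

/-- The tensors `ψ_α`. -/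
def psiT (α : Fin 3) (X : V) : V := ThreeQS.psi F α X

/-- The tensors `θ_α = φ_α - ψ_α`. -/
def thetaT (α : Fin 3) (X : V) : V := ph F V α X - psiT F V α X

/-- The 2-forms `Θ_α(X,Y) = g(X, θ_α Y)`. -/
def ThetaForm (α : Fin 3) (X Y : V) : F := gm F V X (thetaT F V α Y)

end tqs

/-- The 3-quasi-Sasakian manifold has rank `4l+3`: the constant `c` is nonzero
and the orthonormal frame is adapted to the splitting
`TM = E^{4l} ⊕ E^{4m} ⊕ ⟨ξ₁,ξ₂,ξ₃⟩` with `dim E^{4l} = 4l` (hence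
`dim E^{4m} = 4m`, `m = n - l`, and the rank of the `η_α` is `4l+3`). -/
class HasRank (F V : Type) [CommRing F] [Algebra ℝ F] [AddCommGroup V] [Module F V]
    [SmoothSetting F V] [ACM3 F V] [ThreeQS F V] (l : ℕ) : Prop where
  c_ne : cc F V ≠ 0
  l_le : l ≤ dimn F V
  frame_E4l : ∀ i : Fin (4 * dimn F V + 3), i.val < 4 * l → InE4l F V (fr F V i)
  frame_E4m : ∀ i : Fin (4 * dimn F V + 3), 4 * l ≤ i.val → i.val < 4 * dimn F V →
    InE4m F V (fr F V i)
  frame_xi : ∀ (i : Fin (4 * dimn F V + 3)) (a : Fin 3),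
    i.val = 4 * dimn F V + a.val → fr F V i = rxi F V a

/-- The Levi-Civita connection of `g`: the unique torsion-free metric connection. -/
class LeviCivita (F V : Type) [CommRing F] [Algebra ℝ F] [AddCommGroup V] [Module F V]
    [SmoothSetting F V] [ACM3 F V] where
  nabla : V → V → V
  nabla_addLeft : ∀ X Y Z : V, nabla (X + Y) Z = nabla X Z + nabla Y Z
  nabla_smulLeft : ∀ (f : F) (X Y : V), nabla (f • X) Y = f • nabla X Y
  nabla_addRight : ∀ X Y Z : V, nabla X (Y + Z) = nabla X Y + nabla X Z
  nabla_leibniz : ∀ (X : V) (f : F) (Y : V),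
    nabla X (f • Y) = der F V X f • Y + f • nabla X Y
  nabla_metric : ∀ X Y Z : V,
    der F V X (gm F V Y Z) = gm F V (nabla X Y) Z + gm F V Y (nabla X Z)
  nabla_torsionFree : ∀ X Y : V, nabla X Y - nabla Y X = lie F V X Y

section curv

variable (F V : Type) [CommRing F] [Algebra ℝ F] [AddCommGroup V] [Module F V]
  [SmoothSetting F V] [ACM3 F V] [LeviCivita F V]

/-- The Levi-Civita covariant derivative `∇_X Y`. -/
def nab (X Y : V) : V := LeviCivita.nabla F X Y

/-- The Riemannian curvature `R(X,Y)Z = ∇_X ∇_Y Z - ∇_Y ∇_X Z - ∇_{[X,Y]} Z`. -/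
def Rcurv (X Y Z : V) : V :=
  nab F V X (nab F V Y Z) - nab F V Y (nab F V X Z) - nab F V (lie F V X Y) Z

/-- The Ricci tensor `Ric(X,Y) = ∑_i g(R(e_i, X)Y, e_i)`. -/
def Ric (X Y : V) : F :=
  ∑ i, gm F V (Rcurv F V (fr F V i) X Y) (fr F V i)

/-- The scalar curvature. -/
def Scal : F := ∑ i, Ric F V (fr F V i) (fr F V i)

/-- `M` is Einstein: `Ric = a g` for a constant `a`. -/
def Einstein : Prop :=
  ∃ a : ℝ, ∀ X Y, Ric F V X Y = algebraMap ℝ F a * gm F V X Y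

/-- `M` is η-Einstein: `Ric = a g + b ∑_α η_α ⊗ η_α` for constants `a, b`. -/
def EtaEinstein : Prop :=
  ∃ a b : ℝ, ∀ X Y, Ric F V X Y
    = algebraMap ℝ F a * gm F V X Y
      + algebraMap ℝ F b * ∑ α : Fin 3, et F V α X * et F V α Y

end curv

/-- A (Koszul) linear connection on vector fields. -/
def IsConnection (F V : Type) [CommRing F] [Algebra ℝ F] [AddCommGroup V] [Module F V]
    [SmoothSetting F V] (D : V → V → V) : Prop :=
  (∀ X Y Z : V, D (X + Y) Z = D X Z + D Y Z) ∧
  (∀ (f : F) (X Y : V), D (f • X) Y = f • D X Y) ∧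
  (∀ X Y Z : V, D X (Y + Z) = D X Y + D X Z) ∧
  (∀ (X : V) (f : F) (Y : V), D X (f • Y) = der F V X f • Y + f • D X Y)

end QS3

namespace QS3

section smooth

variable {F V : Type} [CommRing F] [Algebra ℝ F] [AddCommGroup V] [Module F V]

theorem eq_zero_of_eq_neg_self {X : V} (F : Type) [CommRing F] [Algebra ℝ F] [Module F V]
    (h : X = -X) : X = 0 := by
  have h2 : (algebraMap ℝ F 2) • X = 0 := by
    rw [map_ofNat, two_smul]
    nth_rewrite 1 [h]
    exact neg_add_cancel X
  have h1 : (algebraMap ℝ F (2⁻¹ * 2)) • X = X := by norm_num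
  rw [← h1, map_mul, mul_smul, h2, smul_zero]

variable [SmoothSetting F V]

theorem der_add (X : V) (f h : F) : der F V X (f + h) = der F V X f + der F V X h :=
  SmoothSetting.act_add X f h

theorem der_zero (X : V) : der F V X 0 = 0 := by
  have := der_add X (0 : F) 0
  simpa using this

theorem der_neg (X : V) (f : F) : der F V X (-f) = -der F V X f := by
  have := der_add X f (-f)
  rw [add_neg_cancel, der_zero] at this
  exact (neg_eq_of_add_eq_zero_right this.symm).symm

theorem der_mul (X : V) (f h : F) : der F V X (f * h) = der F V X f * h + f * der F V X h :=
  SmoothSetting.act_mul X f h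

theorem der_const (X : V) (r : ℝ) : der F V X (algebraMap ℝ F r) = 0 :=
  SmoothSetting.act_const X r

theorem lie_skew (X Y : V) : lie F V X Y = -lie F V Y X :=
  SmoothSetting.bracket_antisymm X Y

theorem lie_self_eq_zero (X : V) : lie F V X X = 0 :=
  eq_zero_of_eq_neg_self F (lie_skew X X)

theorem lie_add_left (X Y Z : V) : lie F V (X + Y) Z = lie F V X Z + lie F V Y Z :=
  SmoothSetting.bracket_addLeft X Y Z

theorem lie_add_right (X Y Z : V) : lie F V X (Y + Z) = lie F V X Y + lie F V X Z := by
  rw [lie_skew, lie_add_left, neg_add, ← lie_skew, ← lie_skew]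

theorem lie_zero_right (X : V) : lie F V X 0 = 0 := by
  have := lie_add_right (F := F) X (0 : V) 0
  simpa using this

theorem lie_neg_right (X Y : V) : lie F V X (-Y) = -lie F V X Y := by
  have := lie_add_right (F := F) X Y (-Y)
  rw [add_neg_cancel, lie_zero_right] at this
  exact (neg_eq_of_add_eq_zero_right this.symm).symm

theorem lie_sub_right (X Y Z : V) : lie F V X (Y - Z) = lie F V X Y - lie F V X Z := by
  rw [sub_eq_add_neg, lie_add_right, lie_neg_right, sub_eq_add_neg]

theorem lie_smul_right (X : V) (f : F) (Y : V) :
    lie F V X (f • Y) = f • lie F V X Y + der F V X f • Y :=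
  SmoothSetting.bracket_smulRight X f Y

theorem lie_const_smul_left (r : ℝ) (X Y : V) :
    lie F V (algebraMap ℝ F r • X) Y = algebraMap ℝ F r • lie F V X Y := by
  rw [lie_skew, lie_smul_right, der_const, zero_smul, add_zero, ← smul_neg, ← lie_skew]

theorem lie_lie_eq (X Y Z : V) :
    lie F V X (lie F V Y Z) = lie F V Y (lie F V X Z) + lie F V (lie F V X Y) Z := by
  have h : lie F V X (lie F V Y Z) + lie F V Y (lie F V Z X) + lie F V Z (lie F V X Y) = 0 :=
    SmoothSetting.jacobi X Y Z
  rw [lie_skew Z X, lie_neg_right, lie_skew Z (lie F V X Y)] at h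
  rw [← sub_eq_zero, ← h]
  abel

/-- The exterior differential of a 1-form, without the factor `1/2`. -/
def extDeriv (θ : V → F) (X Y : V) : F :=
  der F V X (θ Y) - der F V Y (θ X) - θ (lie F V X Y)

theorem dOne_eq_extDeriv (θ : V → F) (X Y : V) :
    dOne F V θ X Y = (2 : ℝ)⁻¹ • extDeriv θ X Y := rfl

end smooth

theorem Cyclic.rotate {a b c : Fin 3} (h : Cyclic a b c) : Cyclic b c a := by
  revert a b c
  unfold Cyclic
  decide

theorem Cyclic.eq_or {a b c : Fin 3} (h : Cyclic a b c) (x : Fin 3) : x = a ∨ x = b ∨ x = c := by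
  revert a b c x
  unfold Cyclic
  decide

theorem exists_cyclic (c : Fin 3) : ∃ a b, Cyclic a b c := by
  revert c
  unfold Cyclic
  decide

theorem eq_or_exists_cyclic (a b : Fin 3) :
    a = b ∨ ∃ c, Cyclic a b c ∨ Cyclic b a c := by
  revert a b
  unfold Cyclic
  decide

section acm

variable {F V : Type} [CommRing F] [Algebra ℝ F] [AddCommGroup V] [Module F V]
  [SmoothSetting F V] [ACM3 F V]

theorem gm_comm (X Y : V) : gm F V X Y = gm F V Y X := ACM3.g_symm X Y

theorem gm_add_left (X Y Z : V) : gm F V (X + Y) Z = gm F V X Z + gm F V Y Z :=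
  ACM3.g_addLeft X Y Z

theorem gm_smul_left (f : F) (X Y : V) : gm F V (f • X) Y = f * gm F V X Y :=
  ACM3.g_smulLeft f X Y

theorem gm_zero_left (Y : V) : gm F V 0 Y = 0 := by
  simpa using gm_smul_left (0 : F) (0 : V) Y

theorem gm_neg_left (X Y : V) : gm F V (-X) Y = -gm F V X Y := by
  simpa using gm_smul_left (-1 : F) X Y

theorem gm_add_right (X Y Z : V) : gm F V X (Y + Z) = gm F V X Y + gm F V X Z := by
  rw [gm_comm, gm_add_left, gm_comm Y, gm_comm Z]

theorem gm_smul_right (f : F) (X Y : V) : gm F V X (f • Y) = f * gm F V X Y := by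
  rw [gm_comm, gm_smul_left, gm_comm Y]

theorem gm_zero_right (X : V) : gm F V X 0 = 0 := by
  rw [gm_comm, gm_zero_left]

theorem gm_neg_right (X Y : V) : gm F V X (-Y) = -gm F V X Y := by
  rw [gm_comm, gm_neg_left, gm_comm Y]

theorem gm_sub_left (X Y Z : V) : gm F V (X - Y) Z = gm F V X Z - gm F V Y Z := by
  rw [sub_eq_add_neg, gm_add_left, gm_neg_left, sub_eq_add_neg]

theorem gm_sub_right (X Y Z : V) : gm F V X (Y - Z) = gm F V X Y - gm F V X Z := by
  rw [sub_eq_add_neg, gm_add_right, gm_neg_right, sub_eq_add_neg]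

theorem eq_zero_of_gm {X : V} (h : ∀ Y, gm F V Y X = 0) : X = 0 :=
  ACM3.g_nondeg (F := F) X fun Y => (gm_comm X Y).trans (h Y)

theorem ph_add (a : Fin 3) (X Y : V) : ph F V a (X + Y) = ph F V a X + ph F V a Y :=
  ACM3.phi_add a X Y

theorem ph_smul (a : Fin 3) (f : F) (X : V) : ph F V a (f • X) = f • ph F V a X :=
  ACM3.phi_smul a f X

theorem ph_zero (a : Fin 3) : ph F V a (0 : V) = 0 := by
  simpa using ph_smul a (0 : F) (0 : V)

theorem ph_neg (a : Fin 3) (X : V) : ph F V a (-X) = -ph F V a X := by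
  simpa using ph_smul a (-1 : F) X

theorem ph_sub (a : Fin 3) (X Y : V) : ph F V a (X - Y) = ph F V a X - ph F V a Y := by
  rw [sub_eq_add_neg, ph_add, ph_neg, sub_eq_add_neg]

theorem et_eq_gm (a : Fin 3) (X : V) : et F V a X = gm F V X (rxi F V a) := ACM3.eta_eq a X

theorem et_add (a : Fin 3) (X Y : V) : et F V a (X + Y) = et F V a X + et F V a Y := by
  simp only [et_eq_gm, gm_add_left]

theorem et_smul (a : Fin 3) (f : F) (X : V) : et F V a (f • X) = f * et F V a X := by
  simp only [et_eq_gm, gm_smul_left]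

theorem et_sub (a : Fin 3) (X Y : V) : et F V a (X - Y) = et F V a X - et F V a Y := by
  simp only [et_eq_gm, gm_sub_left]

theorem et_rxi_self (a : Fin 3) : et F V a (rxi F V a) = 1 := ACM3.eta_xi a

theorem ph_ph (a : Fin 3) (X : V) : ph F V a (ph F V a X) = -X + et F V a X • rxi F V a :=
  ACM3.acm_sq a X

theorem gm_ph_ph (a : Fin 3) (X Y : V) :
    gm F V (ph F V a X) (ph F V a Y) = gm F V X Y - et F V a X * et F V a Y :=
  ACM3.compat a X Y

theorem Cyclic.ph_eq {a b c : Fin 3} (h : Cyclic a b c) (X : V) :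
    ph F V c X = ph F V a (ph F V b X) - et F V b X • rxi F V a :=
  ACM3.quat_phi a b c h X

theorem Cyclic.ph_eq' {a b c : Fin 3} (h : Cyclic a b c) (X : V) :
    ph F V c X = -ph F V b (ph F V a X) + et F V a X • rxi F V b :=
  ACM3.quat_phi' a b c h X

theorem Cyclic.ph_rxi {a b c : Fin 3} (h : Cyclic a b c) :
    ph F V a (rxi F V b) = rxi F V c :=
  (ACM3.quat_xi a b c h).symm

theorem Cyclic.ph_rxi' {a b c : Fin 3} (h : Cyclic a b c) :
    ph F V b (rxi F V a) = -rxi F V c := by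
  have h1 : rxi F V c = -ph F V b (rxi F V a) := ACM3.quat_xi' a b c h
  rw [h1, neg_neg]

theorem eq_zero_of_smul_rxi {a : Fin 3} {f : F} (h : f • rxi F V a = 0) : f = 0 := by
  have h1 := congrArg (gm F V · (rxi F V a)) h
  rwa [gm_smul_left, gm_zero_left, ← et_eq_gm, et_rxi_self, mul_one] at h1

theorem Cyclic.et_rxi {a b c : Fin 3} (h : Cyclic a b c) : et F V a (rxi F V b) = 0 := by
  have h1 := h.ph_eq' (F := F) (rxi F V b)
  rw [h.ph_rxi, h.rotate.ph_rxi, h.rotate.ph_rxi'] at h1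
  exact eq_zero_of_smul_rxi (left_eq_add.mp h1)

theorem Cyclic.et_rxi' {a b c : Fin 3} (h : Cyclic a b c) : et F V b (rxi F V a) = 0 := by
  rw [et_eq_gm, gm_comm, ← et_eq_gm, h.et_rxi]

theorem ph_rxi_self (b : Fin 3) : ph F V b (rxi F V b) = 0 := by
  obtain ⟨c, a, h0⟩ := exists_cyclic b
  have h : Cyclic a b c := h0.rotate
  have h1 : ph F V a (ph F V b (rxi F V b)) = 0 := by
    have := h.ph_eq (F := F) (rxi F V b)
    rw [h.rotate.ph_rxi', et_rxi_self, one_smul, sub_eq_add_neg] at this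
    exact right_eq_add.mp this
  have h2 : ph F V b (rxi F V b)
      = et F V b (ph F V b (rxi F V b)) • rxi F V b := by
    rw [← sub_eq_zero]
    refine eq_zero_of_gm (F := F) fun Z => ?_
    have h3 := gm_ph_ph (F := F) b (rxi F V b) (ph F V b Z)
    rw [ph_ph, gm_add_right, gm_neg_right, gm_smul_right, ← et_eq_gm, et_rxi_self,
      gm_comm (rxi F V b), ← et_eq_gm] at h3
    rw [gm_sub_right, gm_smul_right, ← et_eq_gm, gm_comm Z]
    linear_combination -h3
  rw [h2, ph_smul, h.ph_rxi] at h1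
  rw [h2, eq_zero_of_smul_rxi h1, zero_smul]

theorem et_ph_self (a : Fin 3) (X : V) : et F V a (ph F V a X) = 0 := by
  have h1 := ph_ph (F := F) a (ph F V a X)
  rw [congrArg (ph F V a) (ph_ph a X), ph_add, ph_neg, ph_smul, ph_rxi_self, smul_zero,
    add_zero] at h1
  exact eq_zero_of_smul_rxi (left_eq_add.mp h1)

theorem gm_ph_left (a : Fin 3) (X Y : V) :
    gm F V (ph F V a X) Y = -gm F V X (ph F V a Y) := by
  have h := gm_ph_ph (F := F) a X (ph F V a Y)
  rw [ph_ph, et_ph_self, gm_add_right, gm_neg_right, gm_smul_right, ← et_eq_gm, et_ph_self] at h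
  linear_combination -h

theorem ph_rxi_antisymm (a b : Fin 3) : ph F V b (rxi F V a) = -ph F V a (rxi F V b) := by
  rcases eq_or_exists_cyclic a b with rfl | ⟨c, h | h⟩
  · simp [ph_rxi_self]
  · rw [h.ph_rxi, h.ph_rxi']
  · rw [h.ph_rxi, h.ph_rxi', neg_neg]

theorem der_et_rxi (a b : Fin 3) (X : V) : der F V X (et F V a (rxi F V b)) = 0 := by
  rcases eq_or_exists_cyclic a b with rfl | ⟨c, h | h⟩
  · rw [et_rxi_self, ← map_one (algebraMap ℝ F), der_const]
  · rw [h.et_rxi, der_zero]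
  · rw [h.et_rxi', der_zero]

/-- The Lie derivative of `φ_b` along `ξ_a`. -/
def reebLie (F : Type) {V : Type} [CommRing F] [Algebra ℝ F] [AddCommGroup V] [Module F V]
    [SmoothSetting F V] [ACM3 F V] (a b : Fin 3) (X : V) : V :=
  lie F V (rxi F V a) (ph F V b X) - ph F V b (lie F V (rxi F V a) X)

theorem lie_rxi_ph (a b : Fin 3) (X : V) :
    lie F V (rxi F V a) (ph F V b X) = reebLie F a b X + ph F V b (lie F V (rxi F V a) X) := by
  rw [reebLie, sub_add_cancel]

theorem reebLie_add (a b : Fin 3) (X Y : V) :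
    reebLie F a b (X + Y) = reebLie F a b X + reebLie F a b Y := by
  simp only [reebLie, lie_add_right, ph_add]
  abel

theorem reebLie_smul (a b : Fin 3) (f : F) (X : V) :
    reebLie F a b (f • X) = f • reebLie F a b X := by
  simp only [reebLie, lie_smul_right, ph_add, ph_smul, smul_sub]
  abel

theorem reebLie_neg (a b : Fin 3) (X : V) : reebLie F a b (-X) = -reebLie F a b X := by
  simpa using reebLie_smul a b (-1 : F) X

theorem reebLie_sub (a b : Fin 3) (X Y : V) :
    reebLie F a b (X - Y) = reebLie F a b X - reebLie F a b Y := by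
  rw [sub_eq_add_neg, reebLie_add, reebLie_neg, sub_eq_add_neg]

theorem Horiz.gm_rxi {X : V} (h : Horiz F V X) (a : Fin 3) : gm F V X (rxi F V a) = 0 := by
  rw [← et_eq_gm, h a]

theorem Horiz.ph {X : V} (h : Horiz F V X) (a : Fin 3) : Horiz F V (ph F V a X) := by
  intro b
  rw [et_eq_gm, gm_ph_left]
  rcases eq_or_exists_cyclic a b with rfl | ⟨c, hc | hc⟩
  · rw [ph_rxi_self, gm_zero_right, neg_zero]
  · rw [hc.ph_rxi, h.gm_rxi, neg_zero]
  · rw [hc.ph_rxi', gm_neg_right, h.gm_rxi, neg_zero, neg_zero]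

theorem Horiz.sub {X Y : V} (hX : Horiz F V X) (hY : Horiz F V Y) : Horiz F V (X - Y) := by
  intro b
  rw [et_sub, hX b, hY b, sub_zero]

theorem Horiz.smul {X : V} (hX : Horiz F V X) (f : F) : Horiz F V (f • X) := by
  intro b
  rw [et_smul, hX b, mul_zero]

theorem Horiz.ph_ph {X : V} (h : Horiz F V X) {a b c : Fin 3} (hc : Cyclic a b c) :
    QS3.ph F V a (QS3.ph F V b X) = QS3.ph F V c X := by
  rw [hc.ph_eq X, h b, zero_smul, sub_zero]

theorem Horiz.ph_ph' {X : V} (h : Horiz F V X) {a b c : Fin 3} (hc : Cyclic a b c) :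
    QS3.ph F V b (QS3.ph F V a X) = -QS3.ph F V c X := by
  rw [hc.ph_eq' X, h a, zero_smul, add_zero, neg_neg]

theorem horiz_horComp (X : V) : Horiz F V (horComp F V X) := by
  have h : Cyclic 0 1 2 := Or.inl rfl
  intro x
  simp only [horComp, Fin.sum_univ_three, et_sub, et_add, et_smul]
  rcases h.eq_or x with rfl | rfl | rfl <;>
  simp [et_rxi_self, h.et_rxi, h.et_rxi', h.rotate.et_rxi, h.rotate.et_rxi',
    h.rotate.rotate.et_rxi, h.rotate.rotate.et_rxi']

theorem IsNormal.et_lie {a : Fin 3} (h : IsNormal F V a) (X : V) :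
    et F V a (lie F V (rxi F V a) X) = der F V (rxi F V a) (et F V a X) := by
  have h1 := congrArg (et F V a) (h (rxi F V a) X)
  have h2 : lie F V 0 (ph F V a X) = 0 := by
    rw [lie_skew, lie_zero_right, neg_zero]
  have h3 : et F V a (0 : V) = 0 := by simpa using et_smul a (0 : F) (0 : V)
  simp only [NOne, Nij, et_add, et_sub, et_smul, et_ph_self, et_rxi_self, ph_rxi_self,
    h2, dOne, smul_smul, h3] at h1
  norm_num [der_et_rxi] at h1
  rw [← et_rxi_self (F := F) (V := V) a, der_et_rxi] at h1
  linear_combination -h1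

theorem IsNormal.reebLie_self {a : Fin 3} (h : IsNormal F V a) (X : V) :
    reebLie F a a X = 0 := by
  have h1 := h (rxi F V a) X
  have h2 : ∀ Y, lie F V (0 : V) Y = 0 := fun Y => by
    rw [lie_skew, lie_zero_right, neg_zero]
  have h3 : dOne F V (et F V a) (rxi F V a) X = 0 := by
    rw [dOne, h.et_lie, der_et_rxi, sub_zero, sub_self, smul_zero]
  rw [NOne, Nij, h3, smul_zero, zero_smul, add_zero, ph_rxi_self, h2, h2, ph_zero, add_zero,
    sub_zero] at h1
  have h4 : ph F V a (reebLie F a a X) = 0 := by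
    rw [reebLie, ph_sub, ← neg_eq_zero, neg_sub, h1]
  have h5 : et F V a (reebLie F a a X) = 0 := by
    rw [reebLie, et_sub, et_ph_self, h.et_lie, et_ph_self, der_zero, sub_zero]
  have h6 := ph_ph (F := F) a (reebLie F a a X)
  rw [h4, ph_zero, h5, zero_smul, add_zero] at h6
  exact neg_eq_zero.mp h6.symm

theorem Phi_antisymm (a : Fin 3) (X Y : V) : Phi F V a X Y = -Phi F V a Y X := by
  rw [Phi, Phi, gm_comm X, gm_ph_left]

theorem IsClosedTwo.lieDeriv_Phi {b : Fin 3} (h : IsClosedTwo F V (Phi F V b)) (Z X Y : V) :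
    der F V Z (Phi F V b X Y) - Phi F V b (lie F V Z X) Y - Phi F V b X (lie F V Z Y)
      = -extDeriv (fun W => gm F V W (ph F V b Z)) X Y := by
  have h1 := h Z X Y
  have h2 : ∀ f : F, (3 : ℝ)⁻¹ • f = 0 → f = 0 := fun f hf => by
    have := congrArg ((3 : ℝ) • ·) hf
    simpa [smul_smul] using this
  have h3 := h2 _ h1
  rw [Phi_antisymm b Z X, der_neg, Phi_antisymm b (lie F V Y Z), lie_skew Y Z] at h3
  have h4 : Phi F V b X (-lie F V Z Y) = -Phi F V b X (lie F V Z Y) := by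
    rw [Phi, ph_neg, gm_neg_right, Phi]
  rw [h4] at h3
  rw [extDeriv]
  simp only [Phi] at h3 ⊢
  linear_combination h3

theorem IsQuasiSasakian.killing {a : Fin 3} (h : IsQuasiSasakian F V a) (X Y : V) :
    der F V (rxi F V a) (gm F V X Y)
      = gm F V (lie F V (rxi F V a) X) Y + gm F V X (lie F V (rxi F V a) Y) := by
  have h1 := h.2.lieDeriv_Phi (rxi F V a) X (ph F V a Y)
  have h2 : lie F V (rxi F V a) (ph F V a Y) = ph F V a (lie F V (rxi F V a) Y) := by
    rw [lie_rxi_ph, h.1.reebLie_self, zero_add]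
  simp only [ph_rxi_self, extDeriv, gm_zero_right, der_zero, Phi, h2, ph_ph, gm_add_right,
    gm_neg_right, gm_smul_right, ← et_eq_gm, der_add, der_neg, der_mul, h.1.et_lie] at h1
  linear_combination -h1

theorem gm_reebLie {a b : Fin 3} (ha : IsQuasiSasakian F V a) (hb : IsQuasiSasakian F V b)
    (X Y : V) :
    gm F V X (reebLie F a b Y)
      = -extDeriv (fun W => gm F V W (ph F V b (rxi F V a))) X Y := by
  rw [← hb.2.lieDeriv_Phi]
  simp only [Phi]
  rw [ha.killing, reebLie, gm_sub_right]
  ring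

theorem extDeriv_gm_neg (Z X Y : V) :
    extDeriv (fun W => gm F V W (-Z)) X Y = -extDeriv (fun W => gm F V W Z) X Y := by
  simp only [extDeriv, gm_neg_right, der_neg]
  ring

theorem extDeriv_gm_antisymm (Z X Y : V) :
    extDeriv (fun W => gm F V W Z) X Y = -extDeriv (fun W => gm F V W Z) Y X := by
  simp only [extDeriv]
  rw [lie_skew X Y, gm_neg_left]
  ring

end acm

section tqs

variable {F V : Type} [CommRing F] [Algebra ℝ F] [AddCommGroup V] [Module F V]
  [SmoothSetting F V] [ACM3 F V] [ThreeQS F V]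

theorem quasiSasakian (a : Fin 3) : IsQuasiSasakian F V a := ThreeQS.qs a

theorem reebLie_self (a : Fin 3) (X : V) : reebLie F a a X = 0 :=
  (quasiSasakian a).1.reebLie_self X

theorem reebLie_antisymm (a b : Fin 3) (X : V) : reebLie F a b X = -reebLie F b a X := by
  rw [← sub_eq_zero, sub_neg_eq_add]
  refine eq_zero_of_gm (F := F) fun Y => ?_
  rw [gm_add_right, gm_reebLie (quasiSasakian a) (quasiSasakian b),
    gm_reebLie (quasiSasakian b) (quasiSasakian a), ph_rxi_antisymm, extDeriv_gm_neg]
  ring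

theorem gm_reebLie_antisymm (a b : Fin 3) (X Y : V) :
    gm F V X (reebLie F a b Y) = -gm F V Y (reebLie F a b X) := by
  rw [gm_reebLie (quasiSasakian a) (quasiSasakian b),
    gm_reebLie (quasiSasakian a) (quasiSasakian b), extDeriv_gm_antisymm]

theorem Cyclic.dOne_et {a b c : Fin 3} (h : Cyclic a b c) (X Y : V) :
    dOne F V (et F V c) X Y = (2 : ℝ)⁻¹ • gm F V X (reebLie F a b Y) := by
  rw [gm_reebLie (quasiSasakian a) (quasiSasakian b), h.ph_rxi', extDeriv_gm_neg, neg_neg,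
    dOne_eq_extDeriv]
  simp only [extDeriv, et_eq_gm]

theorem Cyclic.lie_rxi {a b c : Fin 3} (h : Cyclic a b c) :
    lie F V (rxi F V a) (rxi F V b) = algebraMap ℝ F (cc F V) • rxi F V c :=
  ThreeQS.reeb_bracket a b c h

theorem Cyclic.lie_rxi' {a b c : Fin 3} (h : Cyclic a b c) :
    lie F V (rxi F V b) (rxi F V a) = -(algebraMap ℝ F (cc F V) • rxi F V c) := by
  rw [lie_skew, h.lie_rxi]

theorem Horiz.lie_rxi {X : V} (h : Horiz F V X) (a : Fin 3) :
    Horiz F V (lie F V (rxi F V a) X) := by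
  intro b
  have h1 := (quasiSasakian (F := F) (V := V) a).killing X (rxi F V b)
  rw [h.gm_rxi, der_zero, ← et_eq_gm] at h1
  have h2 : gm F V X (lie F V (rxi F V a) (rxi F V b)) = 0 := by
    rcases eq_or_exists_cyclic a b with rfl | ⟨c, hc | hc⟩
    · rw [lie_self_eq_zero, gm_zero_right]
    · rw [hc.lie_rxi, gm_smul_right, h.gm_rxi, mul_zero]
    · rw [hc.lie_rxi', gm_neg_right, gm_smul_right, h.gm_rxi, mul_zero, neg_zero]
  rw [h2, add_zero] at h1
  exact h1.symm

theorem Horiz.reebLie {X : V} (h : Horiz F V X) (a b : Fin 3) : Horiz F V (reebLie F a b X) :=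
  ((h.ph b).lie_rxi a).sub ((h.lie_rxi a).ph b)

/-- The Lie derivative along `ξ_x` of the Lie derivative of `φ_b` along `ξ_y`. -/
def reebLieLie (F : Type) {V : Type} [CommRing F] [Algebra ℝ F] [AddCommGroup V] [Module F V]
    [SmoothSetting F V] [ACM3 F V] (x y b : Fin 3) (X : V) : V :=
  lie F V (rxi F V x) (reebLie F y b X) - reebLie F y b (lie F V (rxi F V x) X)

theorem reebLieLie_antisymm (x a b : Fin 3) (X : V) :
    reebLieLie F x a b X = -reebLieLie F x b a X := by
  rw [reebLieLie, reebLieLie, reebLie_antisymm a b, reebLie_antisymm a b, lie_neg_right]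
  abel

theorem reebLieLie_self (x a : Fin 3) (X : V) : reebLieLie F x a a X = 0 := by
  rw [reebLieLie, reebLie_self, reebLie_self, lie_zero_right, sub_zero]

theorem Cyclic.reebLieLie_comm {x y z : Fin 3} (h : Cyclic x y z) (b : Fin 3) (X : V) :
    reebLieLie F x y b X
      = reebLieLie F y x b X + algebraMap ℝ F (cc F V) • reebLie F z b X := by
  have h1 : ∀ W, lie F V (rxi F V x) (lie F V (rxi F V y) W)
      = lie F V (rxi F V y) (lie F V (rxi F V x) W)
        + algebraMap ℝ F (cc F V) • lie F V (rxi F V z) W := fun W => by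
    rw [lie_lie_eq, h.lie_rxi, lie_const_smul_left]
  simp only [reebLieLie, reebLie, lie_sub_right, h1, ph_add, ph_smul, smul_sub]
  abel

theorem Cyclic.reebLieLie_eq_zero {a b c : Fin 3} (h : Cyclic a b c) (X : V) :
    reebLieLie F b c a X = 0 := by
  refine eq_zero_of_eq_neg_self F ?_
  have h1 := h.rotate.reebLieLie_comm (F := F) a X
  have h2 := h.rotate.rotate.reebLieLie_comm (F := F) b X
  have h3 := h.reebLieLie_comm (F := F) c X
  rw [reebLie_self, smul_zero, add_zero] at h1 h2 h3
  calc reebLieLie F b c a X = -reebLieLie F c a b X := by rw [h1, reebLieLie_antisymm]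
    _ = reebLieLie F a b c X := by rw [h2, reebLieLie_antisymm, neg_neg]
    _ = -reebLieLie F b c a X := by rw [h3, reebLieLie_antisymm]

theorem Cyclic.reebLieLie_eq {a b c : Fin 3} (h : Cyclic a b c) (X : V) :
    reebLieLie F b a b X = algebraMap ℝ F (cc F V) • reebLie F b c X := by
  have h1 := h.reebLieLie_comm (F := F) b X
  rw [reebLieLie_self, reebLie_antisymm c b, smul_neg] at h1
  exact (sub_eq_zero.mp (by rw [sub_eq_add_neg, ← h1]))

variable {a b c : Fin 3}

theorem Horiz.reebLie_ac {X : V} (hX : Horiz F V X) (h : Cyclic a b c) :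
    QS3.reebLie F a c X = QS3.ph F V a (QS3.reebLie F a b X) := by
  rw [QS3.reebLie, ← hX.ph_ph h, ← (hX.lie_rxi a).ph_ph h, lie_rxi_ph, reebLie_self, zero_add,
    ← ph_sub, ← QS3.reebLie]

theorem Horiz.reebLie_ca {X : V} (hX : Horiz F V X) (h : Cyclic a b c) :
    QS3.reebLie F c a X = -QS3.ph F V a (QS3.reebLie F a b X) := by
  rw [reebLie_antisymm, hX.reebLie_ac h]

theorem Horiz.reebLie_bc {X : V} (hX : Horiz F V X) (h : Cyclic a b c) :
    QS3.reebLie F b c X = QS3.ph F V b (QS3.reebLie F a b X) := by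
  rw [hX.reebLie_ca h.rotate.rotate, hX.reebLie_ca h, ph_neg, neg_neg,
    (hX.reebLie a b).ph_ph h.rotate.rotate]

theorem Horiz.reebLie_ph_left {X : V} (hX : Horiz F V X) (h : Cyclic a b c) :
    QS3.reebLie F a b (QS3.ph F V a X) = -QS3.ph F V a (QS3.reebLie F a b X) := by
  rw [← hX.reebLie_ac h, QS3.reebLie, hX.ph_ph' h, lie_rxi_ph a a, reebLie_self, zero_add,
    (hX.lie_rxi a).ph_ph' h, lie_neg_right, QS3.reebLie]
  abel

theorem Horiz.reebLie_ph_right {X : V} (hX : Horiz F V X) (h : Cyclic a b c) :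
    QS3.reebLie F a b (QS3.ph F V b X) = -QS3.ph F V b (QS3.reebLie F a b X) := by
  rw [← hX.reebLie_bc h, reebLie_antisymm, QS3.reebLie, hX.ph_ph h, lie_rxi_ph b b, reebLie_self,
    zero_add, (hX.lie_rxi b).ph_ph h, QS3.reebLie]

theorem Horiz.reebLie_ph {X : V} (hX : Horiz F V X) (h : Cyclic a b c) :
    QS3.reebLie F a b (QS3.ph F V c X) = QS3.ph F V c (QS3.reebLie F a b X) := by
  rw [← hX.ph_ph h, (hX.ph b).reebLie_ph_left h, hX.reebLie_ph_right h, ph_neg, neg_neg,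
    (hX.reebLie a b).ph_ph h]

theorem Horiz.reebLie_reebLie {X : V} (hX : Horiz F V X) (h : Cyclic a b c) :
    QS3.reebLie F a b (QS3.reebLie F a b X)
      = algebraMap ℝ F (cc F V) • QS3.ph F V c (QS3.reebLie F a b X) := by
  have h1 := h.reebLieLie_eq_zero (F := F) X
  have h2 := h.reebLieLie_eq (F := F) X
  rw [reebLieLie, hX.reebLie_ca h, (hX.lie_rxi b).reebLie_ca h, lie_neg_right, lie_rxi_ph,
    reebLie_antisymm b a] at h1
  rw [reebLieLie, hX.reebLie_bc h] at h2
  have h3 := congrArg (QS3.ph F V a) h2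
  rw [ph_sub, ph_smul, (hX.reebLie a b).ph_ph h] at h3
  rw [← h3, ← sub_eq_zero, ← h1]
  abel

theorem Cyclic.reebLie_rxi (h : Cyclic a b c) (x : Fin 3) :
    reebLie F a b (rxi F V x) = algebraMap ℝ F (cc F V) • ph F V c (rxi F V x) := by
  rw [reebLie]
  rcases h.eq_or x with rfl | rfl | rfl
  · rw [lie_self_eq_zero, ph_zero, sub_zero, h.ph_rxi', lie_neg_right,
      h.rotate.rotate.lie_rxi', neg_neg, h.rotate.rotate.ph_rxi]
  · rw [ph_rxi_self, lie_zero_right, h.lie_rxi, ph_smul, h.rotate.ph_rxi, h.rotate.ph_rxi',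
      smul_neg, zero_sub]
  · rw [ph_rxi_self, smul_zero, h.rotate.ph_rxi, lie_self_eq_zero, h.rotate.rotate.lie_rxi',
      ph_neg, ph_smul, ph_rxi_self, smul_zero, neg_zero, sub_zero]

theorem InE4m.reebLie_eq_zero {X : V} (hX : InE4m F V X) (h : Cyclic a b c) :
    reebLie F a b X = 0 := by
  refine eq_zero_of_gm (F := F) fun Y => ?_
  have h1 := hX.2 c Y
  rw [h.dOne_et] at h1
  have h2 := congrArg ((2 : ℝ) • ·) h1
  rw [gm_reebLie_antisymm]
  simpa [smul_smul] using h2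

theorem Horiz.inE4m_of_reebLie_eq_zero {X : V} (hX : Horiz F V X) (h : Cyclic a b c)
    (h0 : QS3.reebLie F a b X = 0) : InE4m F V X := by
  refine ⟨hX, fun x Y => ?_⟩
  rcases h.eq_or x with rfl | rfl | rfl
  · rw [h.rotate.dOne_et, gm_reebLie_antisymm, hX.reebLie_bc h, h0, ph_zero, gm_zero_right,
      neg_zero, smul_zero]
  · rw [h.rotate.rotate.dOne_et, gm_reebLie_antisymm, hX.reebLie_ca h, h0, ph_zero, neg_zero,
      gm_zero_right, neg_zero, smul_zero]
  · rw [h.dOne_et, gm_reebLie_antisymm, h0, gm_zero_right, neg_zero, smul_zero]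

theorem exists_decomposition (X : V) : ∃ Y Z : V, ∃ f : Fin 3 → F, InE4l F V Y ∧ InE4m F V Z ∧
    X = Y + Z + ∑ x, f x • rxi F V x := by
  obtain ⟨Y, Z, hY, hZ, h⟩ := ThreeQS.horiz_split _ (horiz_horComp (F := F) X)
  refine ⟨Y, Z, fun x => et F V x X, hY, hZ, ?_⟩
  rw [← h, horComp, sub_add_cancel]

theorem eq_zero_of_inE4l_of_inE4m {W : V} (hl : InE4l F V W) (hm : InE4m F V W) : W = 0 := by
  refine eq_zero_of_gm (F := F) fun X => ?_
  obtain ⟨Y, Z, f, hY, hZ, rfl⟩ := exists_decomposition (F := F) X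
  rw [gm_comm]
  simp only [Fin.sum_univ_three, gm_add_right, gm_smul_right, hl.1.gm_rxi, hl.2 Z hZ,
    gm_comm W Y, hY.2 W hm, mul_zero, add_zero]

theorem InE4l.reebLie_eq {Y : V} (hY : InE4l F V Y) (h : Cyclic a b c) :
    reebLie F a b Y = algebraMap ℝ F (cc F V) • ph F V c Y := by
  have hh : Horiz F V (reebLie F a b Y - algebraMap ℝ F (cc F V) • ph F V c Y) :=
    (hY.1.reebLie a b).sub ((hY.1.ph c).smul _)
  rw [← sub_eq_zero]
  refine eq_zero_of_inE4l_of_inE4m (F := F) ⟨hh, fun Z hZ => ?_⟩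
    (hh.inE4m_of_reebLie_eq_zero h ?_)
  · rw [gm_sub_left, gm_comm, gm_reebLie_antisymm, hZ.reebLie_eq_zero h, gm_zero_right,
      gm_smul_left, (ThreeQS.phi_E4l c Y hY).2 Z hZ, mul_zero, neg_zero, sub_zero]
  · rw [reebLie_sub, reebLie_smul, hY.1.reebLie_ph h, hY.1.reebLie_reebLie h, sub_self]

theorem psiT_add (a : Fin 3) (X Y : V) : psiT F V a (X + Y) = psiT F V a X + psiT F V a Y :=
  ThreeQS.psi_add a X Y

theorem psiT_smul (a : Fin 3) (f : F) (X : V) : psiT F V a (f • X) = f • psiT F V a X :=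
  ThreeQS.psi_smul a f X

theorem Cyclic.reebLie_eq_psiT (h : Cyclic a b c) (hc : cc F V ≠ 0) (X : V) :
    reebLie F a b X = algebraMap ℝ F (cc F V) • psiT F V c X := by
  have hxi : ∀ x, psiT F V c (rxi F V x) = ph F V c (rxi F V x) :=
    ThreeQS.psi_vert_of_ne hc c
  obtain ⟨Y, Z, f, hY, hZ, rfl⟩ := exists_decomposition (F := F) X
  have hYl : psiT F V c Y = ph F V c Y := ThreeQS.psi_E4l c Y hY
  have hZm : psiT F V c Z = 0 := ThreeQS.psi_E4m c Z hZ
  simp only [Fin.sum_univ_three, reebLie_add, reebLie_smul, psiT_add, psiT_smul,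
    h.reebLie_rxi, hxi, hYl, hZm, hY.reebLie_eq h, hZ.reebLie_eq_zero h, smul_add, smul_zero,
    smul_comm (algebraMap ℝ F (cc F V)) (f _)]

theorem InE4l3.psiT_eq {X : V} (hX : InE4l3 F V X) (hc : cc F V ≠ 0) (a : Fin 3) :
    psiT F V a X = ph F V a X := by
  have hxi : ∀ x, psiT F V a (rxi F V x) = ph F V a (rxi F V x) :=
    ThreeQS.psi_vert_of_ne hc a
  obtain ⟨Y, Z, hY, ⟨p, q, r, rfl⟩, rfl⟩ := hX
  have hYl : psiT F V a Y = ph F V a Y := ThreeQS.psi_E4l a Y hY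
  simp only [psiT_add, psiT_smul, ph_add, ph_smul, hxi, hYl]

end tqs

/-- On a 3-quasi-Sasakian manifold of rank `4l+3` (with
`[ξ_α,ξ_β] = c ξ_γ`, `c ≠ 0`) one has `dη_α(X,Y) = (c/2) g(X, ψ_α Y)` for all
vector fields; consequently `dη_α = (c/2) Φ_α` on `E^{4l+3}`. -/
theorem deta_eq_half_c_psi (F V : Type) [CommRing F] [Algebra ℝ F] [AddCommGroup V] [Module F V]
    [SmoothSetting F V] [ACM3 F V] [ThreeQS F V] (l : ℕ) [HasRank F V l] :
    (∀ (α : Fin 3) (X Y : V),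
      dOne F V (et F V α) X Y
        = algebraMap ℝ F (cc F V / 2) * gm F V X (psiT F V α Y)) ∧
    (∀ (α : Fin 3) (X Y : V), InE4l3 F V X → InE4l3 F V Y →
      dOne F V (et F V α) X Y = algebraMap ℝ F (cc F V / 2) * Phi F V α X Y) := by
  have hc : cc F V ≠ 0 := HasRank.c_ne l
  have key : ∀ (α : Fin 3) (X Y : V), dOne F V (et F V α) X Y
      = algebraMap ℝ F (cc F V / 2) * gm F V X (psiT F V α Y) := by
    intro α X Y
    obtain ⟨a, b, h⟩ := exists_cyclic α
    rw [h.dOne_et, h.reebLie_eq_psiT hc, gm_smul_right, Algebra.smul_def, ← mul_assoc, ← map_mul,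
      inv_mul_eq_div]
  refine ⟨key, fun α X Y _ hY => ?_⟩
  rw [key, hY.psiT_eq hc, Phi]

end QS3
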